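/- Let T > 0 and n, m ∈ ℕ₊. Let A, C, Q, G ∈ ℝ^{n×n} and B, D ∈ ℝ^{n×m} and R ∈ ℝ^{m×m}, with Q, G symmetric positive semidefinite and R symmetric positive definite. Suppose P : [0,T] → ℝ^{n×n} is continuously differentiable, symmetric positive semidefinite valued, with P(T) = G and P′ + PA + AᵀP + CᵀPC + Q − (BᵀP + DᵀPC)ᵀ(R + DᵀPD)⁻¹(BᵀP + DᵀPC) = 0 on [0,T]. For N ∈ ℕ₊ with τ = T/N ≤ 1 and t_k = kτ, define P_N = G and, backwards for k = N−1,…,0, W_k¹ = R + τBᵀP_{k+1}B + DᵀP_{k+1}D, H_k¹ = BᵀP_{k+1}(I + τA) + DᵀP_{k+1}C, P_k = τQ + (I + τA)ᵀP_{k+1}(I + τA) + τCᵀP_{k+1}C − τ(H_k¹)ᵀ(W_k¹)⁻¹H_k¹. Then there exists a constant C₀, depending only on A, B, C, D, Q, R, G, T, n, m (in particular independent of N and τ), such that sup_{t∈[0,T]} ‖P(t)‖ + max_{l=0,…,N} ‖P_l‖ ≤ C₀, ‖P(t) − P(s)‖ ≤ C₀|t − s| for all s, t ∈ [0,T], and max_{k=0,…,N}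 ‖P(t_k) − P_k‖ ≤ C₀√τ. -/

import Mathlib

open Matrix Set

/-- The spectral norm of a real matrix: the operator norm induced by the Euclidean norms. -/
noncomputable def sNorm {p q : ℕ} (M : Matrix (Fin p) (Fin q) ℝ) : ℝ :=
  ‖LinearMap.toContinuousLinearMap (Matrix.toEuclideanLin M)‖

namespace Riccati

open scoped Matrix.Norms.L2Operator

variable {α : Type*} {p q r n m : ℕ}

lemma norm_transpose (M : Matrix (Fin p) (Fin q) ℝ) : ‖Mᵀ‖ = ‖M‖ := by
  rw [← conjTranspose_eq_transpose_of_trivial, l2_opNorm_conjTranspose]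

lemma dotProduct_mulVec_le_norm (Y : Matrix (Fin n) (Fin n) ℝ) (x : EuclideanSpace ℝ (Fin n)) :
    x.ofLp ⬝ᵥ (Y *ᵥ x.ofLp) ≤ ‖Y‖ * ‖x‖ ^ 2 := by
  have h := real_inner_le_norm (WithLp.toLp 2 (Y *ᵥ x.ofLp)) x
  have h' : ‖WithLp.toLp 2 (Y *ᵥ x.ofLp)‖ ≤ ‖Y‖ * ‖x‖ := l2_opNorm_mulVec Y x
  have e : inner ℝ (WithLp.toLp 2 (Y *ᵥ x.ofLp)) x = x.ofLp ⬝ᵥ (Y *ᵥ x.ofLp) := by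
    simp [EuclideanSpace.inner_eq_star_dotProduct]
  rw [e] at h
  nlinarith [norm_nonneg x]

/-- The spectral norm is monotone on positive semidefinite matrices. -/
lemma norm_le_norm_of_posSemidef {X Y : Matrix (Fin n) (Fin n) ℝ} (hX : X.PosSemidef)
    (hXY : (Y - X).PosSemidef) : ‖X‖ ≤ ‖Y‖ := by
  obtain ⟨L, rfl⟩ : ∃ L : Matrix (Fin n) (Fin n) ℝ, X = Lᴴ * L := by
    open scoped MatrixOrder in
    exact CStarAlgebra.nonneg_iff_eq_star_mul_self.mp hX.nonneg
  have hL : ‖L‖ ≤ √‖Y‖ := by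
    rw [l2_opNorm_def]
    refine ContinuousLinearMap.opNorm_le_bound _ (Real.sqrt_nonneg _) fun x => ?_
    refine abs_le_of_sq_le_sq' ?_ (by positivity) |>.2
    rw [mul_pow, Real.sq_sqrt (norm_nonneg Y)]
    refine le_trans ?_ (dotProduct_mulVec_le_norm Y x)
    have h := hXY.dotProduct_mulVec_nonneg x.ofLp
    have e : x.ofLp ⬝ᵥ ((Lᴴ * L) *ᵥ x.ofLp) = ‖WithLp.toLp 2 (L *ᵥ x.ofLp)‖ ^ 2 := by
      rw [EuclideanSpace.real_norm_sq_eq, ← mulVec_mulVec, dotProduct_mulVec,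
        conjTranspose_eq_transpose_of_trivial, vecMul_transpose]
      simp [dotProduct, sq]
    rw [sub_mulVec, dotProduct_sub] at h
    simp only [star_trivial] at h
    rw [e] at h
    exact sub_nonneg.mp h
  rw [l2_opNorm_conjTranspose_mul_self, ← Real.mul_self_sqrt (norm_nonneg Y)]
  gcongr

/-- Matrix inversion is antitone with respect to adding a positive semidefinite matrix. -/
lemma posSemidef_inv_sub_inv_add {R S : Matrix (Fin m) (Fin m) ℝ} (hR : R.PosDef)
    (hS : S.PosSemidef) : (R⁻¹ - (R + S)⁻¹).PosSemidef := by
  have hW : (R + S).PosDef := hR.add_posSemidef hS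
  have h1 : (S + Sᴴ * R⁻¹ * S).PosSemidef := hS.add (hR.inv.posSemidef.conjTranspose_mul_mul_same S)
  have h2 := h1.conjTranspose_mul_mul_same (R + S)⁻¹
  have dR : IsUnit R.det := (isUnit_iff_isUnit_det _).mp hR.isUnit
  have dW : IsUnit (R + S).det := (isUnit_iff_isUnit_det _).mp hW.isUnit
  convert h2 using 1
  rw [hW.inv.isHermitian.eq, hS.isHermitian.eq]
  have e : S + S * R⁻¹ * S = (R + S) * R⁻¹ * (R + S) - (R + S) := by
    simp only [add_mul, mul_add, mul_nonsing_inv _ dR, one_mul, nonsing_inv_mul_cancel_right _ _ dR]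
    abel
  rw [e, mul_sub, sub_mul, mul_assoc (R + S), nonsing_inv_mul_cancel_left _ _ dW,
    mul_nonsing_inv_cancel_right _ _ dW, nonsing_inv_mul _ dW, one_mul]

lemma norm_inv_add_le {R S : Matrix (Fin m) (Fin m) ℝ} (hR : R.PosDef) (hS : S.PosSemidef) :
    ‖(R + S)⁻¹‖ ≤ ‖R⁻¹‖ :=
  norm_le_norm_of_posSemidef (hR.add_posSemidef hS).inv.posSemidef (posSemidef_inv_sub_inv_add hR hS)

/-- A matrix-valued map that is bounded and Lipschitz on a set, with a common constant. -/
def BoundedLipschitzOn [PseudoMetricSpace α] (S : Set α) (f : α → Matrix (Fin p) (Fin q) ℝ) :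
    Prop :=
  ∃ K : ℝ, 0 ≤ K ∧ (∀ x ∈ S, ‖f x‖ ≤ K) ∧ ∀ x ∈ S, ∀ y ∈ S, ‖f x - f y‖ ≤ K * dist x y

namespace BoundedLipschitzOn

variable [PseudoMetricSpace α] {S : Set α} {f g : α → Matrix (Fin p) (Fin q) ℝ}

lemma const (M : Matrix (Fin p) (Fin q) ℝ) : BoundedLipschitzOn S fun _ => M :=
  ⟨‖M‖, norm_nonneg M, fun _ _ => le_rfl, fun x _ y _ => by
    rw [sub_self, norm_zero]; positivity⟩

lemma add (hf : BoundedLipschitzOn S f) (hg : BoundedLipschitzOn S g) :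
    BoundedLipschitzOn S fun x => f x + g x := by
  obtain ⟨K, hK, hb, hl⟩ := hf
  obtain ⟨K', hK', hb', hl'⟩ := hg
  refine ⟨K + K', by positivity, fun x hx => (norm_add_le _ _).trans
    (add_le_add (hb x hx) (hb' x hx)), fun x hx y hy => ?_⟩
  rw [add_sub_add_comm, add_mul]
  exact (norm_add_le _ _).trans (add_le_add (hl x hx y hy) (hl' x hx y hy))

lemma neg (hf : BoundedLipschitzOn S f) : BoundedLipschitzOn S fun x => -f x := by
  obtain ⟨K, hK, hb, hl⟩ := hf
  refine ⟨K, hK, fun x hx => (norm_neg (f x)).trans_le (hb x hx), fun x hx y hy => ?_⟩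
  rw [← neg_sub', norm_neg]
  exact hl x hx y hy

lemma sub (hf : BoundedLipschitzOn S f) (hg : BoundedLipschitzOn S g) :
    BoundedLipschitzOn S fun x => f x - g x := by
  simpa only [sub_eq_add_neg] using hf.add hg.neg

lemma transpose (hf : BoundedLipschitzOn S f) : BoundedLipschitzOn S fun x => (f x)ᵀ := by
  obtain ⟨K, hK, hb, hl⟩ := hf
  refine ⟨K, hK, fun x hx => (norm_transpose _).trans_le (hb x hx), fun x hx y hy => ?_⟩
  rw [← transpose_sub, norm_transpose]
  exact hl x hx y hy

lemma mul {g : α → Matrix (Fin q) (Fin r) ℝ} (hf : BoundedLipschitzOn S f)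
    (hg : BoundedLipschitzOn S g) : BoundedLipschitzOn S fun x => f x * g x := by
  obtain ⟨K, hK, hb, hl⟩ := hf
  obtain ⟨K', hK', hb', hl'⟩ := hg
  refine ⟨2 * (K * K'), by positivity, fun x hx => ?_, fun x hx y hy => ?_⟩
  · calc ‖f x * g x‖ ≤ ‖f x‖ * ‖g x‖ := l2_opNorm_mul _ _
      _ ≤ K * K' := by gcongr; exacts [hb x hx, hb' x hx]
      _ ≤ 2 * (K * K') := by nlinarith [mul_nonneg hK hK']
  · have e : f x * g x - f y * g y = f x * (g x - g y) + (f x - f y) * g y := by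
      rw [Matrix.mul_sub, Matrix.sub_mul]; abel
    calc ‖f x * g x - f y * g y‖ ≤ ‖f x * (g x - g y)‖ + ‖(f x - f y) * g y‖ := by
          rw [e]; exact norm_add_le _ _
      _ ≤ ‖f x‖ * ‖g x - g y‖ + ‖f x - f y‖ * ‖g y‖ :=
          add_le_add (l2_opNorm_mul _ _) (l2_opNorm_mul _ _)
      _ ≤ K * (K' * dist x y) + (K * dist x y) * K' := by
          gcongr
          exacts [hb x hx, hl' x hx y hy, hl x hx y hy, hb' y hy]
      _ = 2 * (K * K') * dist x y := by ring

lemma inv {f : α → Matrix (Fin m) (Fin m) ℝ} (hf : BoundedLipschitzOn S f) {κ : ℝ} (hκ : 0 ≤ κ)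
    (hu : ∀ x ∈ S, IsUnit (f x)) (hi : ∀ x ∈ S, ‖(f x)⁻¹‖ ≤ κ) :
    BoundedLipschitzOn S fun x => (f x)⁻¹ := by
  obtain ⟨K, hK, hb, hl⟩ := hf
  refine ⟨κ + κ * K * κ, by positivity, fun x hx => (hi x hx).trans
    (le_add_of_nonneg_right (by positivity)), fun x hx y hy => ?_⟩
  have dx : IsUnit (f x).det := (isUnit_iff_isUnit_det _).mp (hu x hx)
  have dy : IsUnit (f y).det := (isUnit_iff_isUnit_det _).mp (hu y hy)
  have e : (f x)⁻¹ - (f y)⁻¹ = (f x)⁻¹ * (f y - f x) * (f y)⁻¹ := by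
    rw [mul_sub, sub_mul, mul_nonsing_inv_cancel_right _ _ dy, nonsing_inv_mul _ dx, one_mul]
  have hl' : ‖f y - f x‖ ≤ K * dist x y := by rw [norm_sub_rev]; exact hl x hx y hy
  calc ‖(f x)⁻¹ - (f y)⁻¹‖ ≤ ‖(f x)⁻¹‖ * ‖f y - f x‖ * ‖(f y)⁻¹‖ := by
        rw [e]; exact norm_mul₃_le
    _ ≤ κ * (K * dist x y) * κ := by gcongr; exacts [hi x hx, hi y hy]
    _ ≤ (κ + κ * K * κ) * dist x y := by
        have : 0 ≤ κ * dist x y := by positivity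
        linarith

end BoundedLipschitzOn

/-- The backward Euler increment quotient of the difference Riccati equation; at step size `0` it
is the right-hand side of the Riccati differential equation. -/
noncomputable def increment (A Cm Q : Matrix (Fin n) (Fin n) ℝ) (B D : Matrix (Fin n) (Fin m) ℝ)
    (R : Matrix (Fin m) (Fin m) ℝ) (τ : ℝ) (X : Matrix (Fin n) (Fin n) ℝ) :
    Matrix (Fin n) (Fin n) ℝ :=
  Q + X * A + Aᵀ * X + Aᵀ * X * (τ • A) + Cmᵀ * X * Cm
    - (Bᵀ * X * (1 + τ • A) + Dᵀ * X * Cm)ᵀ * (R + (τ • (Bᵀ * X * B) + Dᵀ * X * D))⁻¹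
        * (Bᵀ * X * (1 + τ • A) + Dᵀ * X * Cm)

lemma add_smul_increment (A Cm Q : Matrix (Fin n) (Fin n) ℝ) (B D : Matrix (Fin n) (Fin m) ℝ)
    (R : Matrix (Fin m) (Fin m) ℝ) (τ : ℝ) (X : Matrix (Fin n) (Fin n) ℝ) :
    X + τ • increment A Cm Q B D R τ X =
      τ • Q + (1 + τ • A)ᵀ * X * (1 + τ • A) + τ • (Cmᵀ * X * Cm)
        - τ • ((Bᵀ * X * (1 + τ • A) + Dᵀ * X * Cm)ᵀ
            * (R + τ • (Bᵀ * X * B) + Dᵀ * X * D)⁻¹ * (Bᵀ * X * (1 + τ • A) + Dᵀ * X * Cm)) := by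
  rw [increment, ← add_assoc R]
  generalize (Bᵀ * X * (1 + τ • A) + Dᵀ * X * Cm)ᵀ
    * (R + τ • (Bᵀ * X * B) + Dᵀ * X * D)⁻¹ * (Bᵀ * X * (1 + τ • A) + Dᵀ * X * Cm) = Z
  simp only [transpose_add, transpose_one, transpose_smul, add_mul, mul_add, one_mul, mul_one,
    smul_mul_assoc, mul_smul_comm, smul_add, smul_sub]
  abel

lemma posSemidef_transpose_mul_mul {X : Matrix (Fin p) (Fin p) ℝ} (hX : X.PosSemidef)
    (M : Matrix (Fin p) (Fin q) ℝ) : (Mᵀ * X * M).PosSemidef := by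
  simpa only [conjTranspose_eq_transpose_of_trivial] using hX.conjTranspose_mul_mul_same M

lemma posSemidef_weight {B D : Matrix (Fin n) (Fin m) ℝ} {τ : ℝ} (hτ : 0 ≤ τ)
    {X : Matrix (Fin n) (Fin n) ℝ} (hX : X.PosSemidef) :
    (τ • (Bᵀ * X * B) + Dᵀ * X * D).PosSemidef :=
  ((posSemidef_transpose_mul_mul hX B).smul hτ).add (posSemidef_transpose_mul_mul hX D)

lemma completion_of_square (E Cm X : Matrix (Fin n) (Fin n) ℝ) (B D : Matrix (Fin n) (Fin m) ℝ)
    (R : Matrix (Fin m) (Fin m) ℝ) (τ : ℝ) (hX : Xᵀ = X) (H : Matrix (Fin m) (Fin n) ℝ)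
    (W : Matrix (Fin m) (Fin m) ℝ) (hW : W = R + τ • (Bᵀ * X * B) + Dᵀ * X * D)
    (hH : H = Bᵀ * X * E + Dᵀ * X * Cm) (hWs : Wᵀ = W) (hWu : IsUnit W.det) :
    Eᵀ * X * E + τ • (Cmᵀ * X * Cm) - τ • (Hᵀ * W⁻¹ * H) =
      (E - τ • (B * (W⁻¹ * H)))ᵀ * X * (E - τ • (B * (W⁻¹ * H)))
        + τ • ((Cm - D * (W⁻¹ * H))ᵀ * X * (Cm - D * (W⁻¹ * H)))
        + τ • ((W⁻¹ * H)ᵀ * R * (W⁻¹ * H)) := by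
  have hWK : W * (W⁻¹ * H) = H := mul_nonsing_inv_cancel_left _ _ hWu
  have hK : Hᵀ * W⁻¹ * H = (W⁻¹ * H)ᵀ * W * (W⁻¹ * H) := by
    rw [Matrix.mul_assoc _ W, hWK, transpose_mul, transpose_nonsing_inv, hWs]
  have h1 : (W⁻¹ * H)ᵀ * W * (W⁻¹ * H) = (W⁻¹ * H)ᵀ * H := by rw [Matrix.mul_assoc _ W, hWK]
  have h2 : Hᵀ * (W⁻¹ * H) = (W⁻¹ * H)ᵀ * H := by rw [← h1, ← hK, Matrix.mul_assoc]
  have hHt : Hᵀ = Eᵀ * X * B + Cmᵀ * X * D := by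
    rw [hH]; simp only [transpose_add, transpose_mul, transpose_transpose, hX, Matrix.mul_assoc]
  rw [hK]
  generalize W⁻¹ * H = K at *
  have hR : R = W - τ • (Bᵀ * X * B) - Dᵀ * X * D := by rw [hW]; abel
  have h3 : Kᵀ * (Bᵀ * X * E) + Kᵀ * (Dᵀ * X * Cm) = Kᵀ * W * K := by
    rw [h1, hH, Matrix.mul_add]
  have h4 : Eᵀ * X * B * K + Cmᵀ * X * D * K = Kᵀ * W * K := by
    rw [h1, ← h2, hHt, Matrix.add_mul]
  have h3' := eq_sub_of_add_eq h3
  have h4' := eq_sub_of_add_eq h4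
  rw [hR]
  simp only [transpose_sub, transpose_smul, transpose_mul, Matrix.sub_mul, Matrix.mul_sub,
    Matrix.smul_mul, Matrix.mul_smul, smul_sub, ← Matrix.mul_assoc] at h3' h4' ⊢
  rw [h3', h4']
  simp only [smul_sub]
  abel

lemma posSemidef_add_smul_increment {A Cm Q : Matrix (Fin n) (Fin n) ℝ}
    {B D : Matrix (Fin n) (Fin m) ℝ} {R : Matrix (Fin m) (Fin m) ℝ} (hQ : Q.PosSemidef)
    (hR : R.PosDef) {τ : ℝ} (hτ : 0 ≤ τ) {X : Matrix (Fin n) (Fin n) ℝ} (hX : X.PosSemidef) :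
    (X + τ • increment A Cm Q B D R τ X).PosSemidef := by
  have hW : (R + τ • (Bᵀ * X * B) + Dᵀ * X * D).PosDef := by
    rw [add_assoc]; exact hR.add_posSemidef (posSemidef_weight hτ hX)
  have hsymm {k : ℕ} {M : Matrix (Fin k) (Fin k) ℝ} (hM : M.IsHermitian) : Mᵀ = M := by
    rw [← conjTranspose_eq_transpose_of_trivial]; exact hM.eq
  rw [add_smul_increment, add_assoc, add_sub_assoc,
    completion_of_square _ Cm X B D R τ (hsymm hX.isHermitian) _ _ rfl rfl
      (hsymm hW.isHermitian) ((isUnit_iff_isUnit_det _).mp hW.isUnit)]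
  exact (hQ.smul hτ).add (((posSemidef_transpose_mul_mul hX _).add
    ((posSemidef_transpose_mul_mul hX _).smul hτ)).add
      ((posSemidef_transpose_mul_mul hR.posSemidef _).smul hτ))

lemma norm_transpose_mul_mul_le (X : Matrix (Fin p) (Fin p) ℝ) (M : Matrix (Fin p) (Fin q) ℝ) :
    ‖Mᵀ * X * M‖ ≤ ‖M‖ ^ 2 * ‖X‖ := by
  calc ‖Mᵀ * X * M‖ ≤ ‖Mᵀ‖ * ‖X‖ * ‖M‖ := (l2_opNorm_mul _ _).trans (by
        gcongr; exact l2_opNorm_mul _ _)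
    _ = ‖M‖ ^ 2 * ‖X‖ := by rw [norm_transpose]; ring

lemma norm_add_smul_increment_le {A Cm Q : Matrix (Fin n) (Fin n) ℝ}
    {B D : Matrix (Fin n) (Fin m) ℝ} {R : Matrix (Fin m) (Fin m) ℝ} (hQ : Q.PosSemidef)
    (hR : R.PosDef) {τ : ℝ} (hτ : 0 ≤ τ) (hτ1 : τ ≤ 1) {X : Matrix (Fin n) (Fin n) ℝ}
    (hX : X.PosSemidef) :
    ‖X + τ • increment A Cm Q B D R τ X‖ ≤
      (1 + (2 * ‖A‖ + ‖A‖ ^ 2 + ‖Cm‖ ^ 2) * τ) * ‖X‖ + τ * ‖Q‖ := by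
  have hW : (R + τ • (Bᵀ * X * B) + Dᵀ * X * D).PosDef := by
    rw [add_assoc]; exact hR.add_posSemidef (posSemidef_weight hτ hX)
  have h : ‖X + τ • increment A Cm Q B D R τ X‖ ≤
      ‖X + τ • (Q + X * A + Aᵀ * X + Aᵀ * X * (τ • A) + Cmᵀ * X * Cm)‖ := by
    refine norm_le_norm_of_posSemidef (posSemidef_add_smul_increment hQ hR hτ hX) ?_
    rw [add_sub_add_left_eq_sub, ← smul_sub, increment, sub_sub_cancel, ← add_assoc R]
    exact (posSemidef_transpose_mul_mul hW.inv.posSemidef _).smul hτ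
  refine h.trans ?_
  have hn (M N : Matrix (Fin n) (Fin n) ℝ) : ‖M * N‖ ≤ ‖M‖ * ‖N‖ := l2_opNorm_mul M N
  have h1 : ‖X * A‖ ≤ ‖X‖ * ‖A‖ := hn _ _
  have h2 : ‖Aᵀ * X‖ ≤ ‖A‖ * ‖X‖ := (hn _ _).trans_eq (by rw [norm_transpose])
  have h3 : ‖Aᵀ * X * (τ • A)‖ ≤ ‖A‖ ^ 2 * ‖X‖ := by
    rw [Matrix.mul_smul, norm_smul, Real.norm_of_nonneg hτ]
    exact (mul_le_of_le_one_left (norm_nonneg _) hτ1).trans (norm_transpose_mul_mul_le X A)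
  have h4 := norm_transpose_mul_mul_le X Cm
  calc _ ≤ ‖X‖ + τ * (‖Q‖ + ‖X * A‖ + ‖Aᵀ * X‖ + ‖Aᵀ * X * (τ • A)‖ + ‖Cmᵀ * X * Cm‖) := by
        refine (norm_add_le _ _).trans ?_
        rw [norm_smul, Real.norm_of_nonneg hτ]
        gcongr
        exact norm_add₄_le.trans (by gcongr; exact norm_add_le _ _)
    _ ≤ ‖X‖ + τ * (‖Q‖ + ‖X‖ * ‖A‖ + ‖A‖ * ‖X‖ + ‖A‖ ^ 2 * ‖X‖ + ‖Cm‖ ^ 2 * ‖X‖) := by gcongr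
    _ = _ := by ring

/-- Discrete backward Grönwall inequality. -/
lemma backward_gronwall {a : ℕ → ℝ} {N : ℕ} {τ L b : ℝ} (hτ : 0 ≤ τ) (hL : 0 ≤ L) (hb : 0 ≤ b)
    (hN : 0 ≤ a N) (h : ∀ k < N, a k ≤ (1 + L * τ) * a (k + 1) + τ * b) :
    ∀ k ≤ N, a k ≤ Real.exp (L * (N * τ)) * (a N + N * τ * b) := by
  have key : ∀ j ≤ N, a (N - j) ≤ Real.exp (L * (j * τ)) * (a N + j * τ * b) := by
    intro j
    induction j with
    | zero => simp
    | succ j ih =>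
      intro hj
      have h1 := h (N - (j + 1)) (by omega)
      rw [show N - (j + 1) + 1 = N - j by omega] at h1
      have h2 : 1 + L * τ ≤ Real.exp (L * τ) := by linarith [Real.add_one_le_exp (L * τ)]
      have h3 : 1 ≤ Real.exp (L * ((j + 1 : ℕ) * τ)) := Real.one_le_exp (by positivity)
      calc a (N - (j + 1)) ≤ (1 + L * τ) * a (N - j) + τ * b := h1
        _ ≤ (1 + L * τ) * (Real.exp (L * (j * τ)) * (a N + j * τ * b)) + τ * b := by
          gcongr; exact ih (by omega)
        _ ≤ Real.exp (L * τ) * (Real.exp (L * (j * τ)) * (a N + j * τ * b))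
            + Real.exp (L * ((j + 1 : ℕ) * τ)) * (τ * b) := by
          have h4 := le_mul_of_one_le_left (mul_nonneg hτ hb) h3
          gcongr
        _ = Real.exp (L * ((j + 1 : ℕ) * τ)) * (a N + (j + 1 : ℕ) * τ * b) := by
          rw [← mul_assoc, ← Real.exp_add]
          push_cast
          ring_nf
  intro k hk
  have hkN := key (N - k) (by omega)
  rw [Nat.sub_sub_self hk] at hkN
  have hle : ((N - k : ℕ) : ℝ) ≤ N := by exact_mod_cast Nat.sub_le N k
  exact hkN.trans (by gcongr)

/-- The pairs of a step size in `[0, 1]` and a positive semidefinite matrix of norm at most `M`. -/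
def admissible (n : ℕ) (M : ℝ) : Set (ℝ × Matrix (Fin n) (Fin n) ℝ) :=
  {x | x.1 ∈ Icc 0 1 ∧ x.2.PosSemidef ∧ ‖x.2‖ ≤ M}

lemma boundedLipschitzOn_snd {M : ℝ} (hM : 0 ≤ M) :
    BoundedLipschitzOn (admissible n M) fun x => x.2 :=
  ⟨M + 1, by positivity, fun x hx => by linarith [hx.2.2], fun x _ y _ => by
    rw [← dist_eq_norm]
    have h : dist x.2 y.2 ≤ dist x y := le_max_right _ _
    nlinarith [dist_nonneg (x := x) (y := y)]⟩

lemma boundedLipschitzOn_fst_smul {M : ℝ}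
    {f : ℝ × Matrix (Fin n) (Fin n) ℝ → Matrix (Fin p) (Fin q) ℝ}
    (hf : BoundedLipschitzOn (admissible n M) f) :
    BoundedLipschitzOn (admissible n M) fun x => x.1 • f x := by
  have h : BoundedLipschitzOn (admissible n M)
      fun x => x.1 • (1 : Matrix (Fin p) (Fin p) ℝ) := by
    refine ⟨‖(1 : Matrix (Fin p) (Fin p) ℝ)‖, norm_nonneg _, fun x hx => ?_, fun x _ y _ => ?_⟩
    · rw [norm_smul, Real.norm_of_nonneg hx.1.1]
      exact mul_le_of_le_one_left (norm_nonneg _) hx.1.2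
    · rw [← sub_smul, norm_smul, ← dist_eq_norm, mul_comm]
      gcongr
      exact le_max_left _ _
  simpa using h.mul hf

lemma boundedLipschitzOn_increment (A Cm Q : Matrix (Fin n) (Fin n) ℝ)
    (B D : Matrix (Fin n) (Fin m) ℝ) {R : Matrix (Fin m) (Fin m) ℝ} (hR : R.PosDef) {M : ℝ}
    (hM : 0 ≤ M) :
    BoundedLipschitzOn (admissible n M) fun x => increment A Cm Q B D R x.1 x.2 := by
  have hX := boundedLipschitzOn_snd (n := n) hM
  have hc {a b : ℕ} (Y : Matrix (Fin a) (Fin b) ℝ) :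
      BoundedLipschitzOn (admissible n M) fun _ => Y := .const Y
  have hτA := boundedLipschitzOn_fst_smul (hc A)
  have hH := (((hc Bᵀ).mul hX).mul ((hc 1).add hτA)).add (((hc Dᵀ).mul hX).mul (hc Cm))
  have hW := (hc R).add ((boundedLipschitzOn_fst_smul (((hc Bᵀ).mul hX).mul (hc B))).add
    (((hc Dᵀ).mul hX).mul (hc D)))
  have hWi := hW.inv (norm_nonneg R⁻¹)
    (fun x hx => (hR.add_posSemidef (posSemidef_weight hx.1.1 hx.2.1)).isUnit)
    (fun x hx => norm_inv_add_le hR (posSemidef_weight hx.1.1 hx.2.1))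
  exact (((((hc Q).add (hX.mul (hc A))).add ((hc Aᵀ).mul hX)).add
    (((hc Aᵀ).mul hX).mul hτA)).add (((hc Cmᵀ).mul hX).mul (hc Cm))).sub
      ((hH.transpose.mul hWi).mul hH)

lemma hasDerivAt_of_entries {P : ℝ → Matrix (Fin p) (Fin q) ℝ} {P' : Matrix (Fin p) (Fin q) ℝ}
    {t : ℝ} (h : ∀ i j, HasDerivAt (fun s => P s i j) (P' i j) t) : HasDerivAt P P' t := by
  have e (M : Matrix (Fin p) (Fin q) ℝ) : M = ∑ i, ∑ j, M i j • single i j (1 : ℝ) := by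
    simpa using matrix_eq_sum_single M
  rw [show P = fun s => ∑ i, ∑ j, P s i j • single i j (1 : ℝ) from funext fun s => e (P s), e P']
  exact .fun_sum fun i _ => .fun_sum fun j _ => (h i j).smul_const _

lemma increment_zero_eq_neg {A Cm Q X X' : Matrix (Fin n) (Fin n) ℝ}
    {B D : Matrix (Fin n) (Fin m) ℝ} {R : Matrix (Fin m) (Fin m) ℝ}
    (h : X' + X * A + Aᵀ * X + Cmᵀ * X * Cm + Q
        - (Bᵀ * X + Dᵀ * X * Cm)ᵀ * (R + Dᵀ * X * D)⁻¹ * (Bᵀ * X + Dᵀ * X * Cm) = 0) :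
    X' = -increment A Cm Q B D R 0 X := by
  rw [increment]
  simp only [zero_smul, add_zero, Matrix.mul_one, Matrix.mul_zero, zero_add]
  rw [eq_neg_iff_add_eq_zero, ← h]
  abel

/-- Local error of one backward step of size `t - s` for the equation with right-hand side `-F 0`. -/
lemma norm_sub_add_smul_le {V : Type*} [NormedAddCommGroup V] [NormedSpace ℝ V] {P : ℝ → V}
    {F : ℝ → V → V} {s t C : ℝ} (hst : s ≤ t)
    (hder : ∀ x ∈ Icc s t, HasDerivAt P (-F 0 (P x)) x)
    (hF : ∀ x ∈ Icc s t, ‖F (t - s) (P t) - F 0 (P x)‖ ≤ C) :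
    ‖P s - (P t + (t - s) • F (t - s) (P t))‖ ≤ (t - s) * C := by
  have h := (convex_Icc s t).norm_image_sub_le_of_norm_hasDerivWithin_le
    (f := fun x => P x + x • F (t - s) (P t))
    (f' := fun x => -F 0 (P x) + (1 : ℝ) • F (t - s) (P t)) (C := C)
    (fun x hx => ((hder x hx).add ((hasDerivAt_id x).smul_const _)).hasDerivWithinAt)
    (fun x hx => by rw [one_smul, neg_add_eq_sub]; exact hF x hx)
    (left_mem_Icc.mpr hst) (right_mem_Icc.mpr hst)
  rw [Real.norm_of_nonneg (sub_nonneg.mpr hst), norm_sub_rev, mul_comm] at h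
  convert! h using 2
  rw [sub_smul]
  abel

/-- The discrete Riccati iterates stay positive semidefinite and bounded uniformly in the mesh. -/
lemma posSemidef_and_norm_le_of_recursion {A Cm Q : Matrix (Fin n) (Fin n) ℝ}
    {B D : Matrix (Fin n) (Fin m) ℝ} {R : Matrix (Fin m) (Fin m) ℝ} (hQ : Q.PosSemidef)
    (hR : R.PosDef) {τ : ℝ} (hτ : 0 ≤ τ) (hτ1 : τ ≤ 1) {N : ℕ}
    {Pd : ℕ → Matrix (Fin n) (Fin n) ℝ} (hN : (Pd N).PosSemidef)
    (hstep : ∀ k < N, Pd k = Pd (k + 1) + τ • increment A Cm Q B D R τ (Pd (k + 1))) :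
    ∀ k ≤ N, (Pd k).PosSemidef ∧
      ‖Pd k‖ ≤ Real.exp ((2 * ‖A‖ + ‖A‖ ^ 2 + ‖Cm‖ ^ 2) * (N * τ)) * (‖Pd N‖ + N * τ * ‖Q‖) := by
  have hpsd : ∀ k ≤ N, (Pd k).PosSemidef := fun k hk => by
    induction hk using Nat.decreasingInduction with
    | self => exact hN
    | of_succ k hk ih =>
      rw [hstep k hk]
      exact posSemidef_add_smul_increment hQ hR hτ ih
  refine fun k hk => ⟨hpsd k hk, backward_gronwall (a := fun k => ‖Pd k‖) hτ (by positivity)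
    (norm_nonneg Q) (norm_nonneg _) (fun k hk => ?_) k hk⟩
  rw [hstep k hk]
  exact norm_add_smul_increment_le hQ hR hτ hτ1 (hpsd (k + 1) hk)

/-- Stability of one-step recursions: local errors `τ * b` accumulate to `O(b)`. -/
lemma norm_sub_le_of_local_error {V : Type*} [NormedAddCommGroup V] [NormedSpace ℝ V]
    {F : V → V} {X Y : ℕ → V} {N : ℕ} {τ L b : ℝ} (hτ : 0 ≤ τ) (hL : 0 ≤ L) (hb : 0 ≤ b)
    (hXY : X N = Y N) (hY : ∀ k < N, Y k = Y (k + 1) + τ • F (Y (k + 1)))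
    (hX : ∀ k < N, ‖X k - (X (k + 1) + τ • F (X (k + 1)))‖ ≤ τ * b)
    (hF : ∀ k < N, ‖F (X (k + 1)) - F (Y (k + 1))‖ ≤ L * ‖X (k + 1) - Y (k + 1)‖) :
    ∀ k ≤ N, ‖X k - Y k‖ ≤ Real.exp (L * (N * τ)) * (N * τ * b) := by
  intro k hk
  have h := backward_gronwall (a := fun k => ‖X k - Y k‖) hτ hL hb (norm_nonneg _)
    (fun k hk => ?_) k hk
  · simpa [hXY] using h
  have e : X k - Y k = (X (k + 1) - Y (k + 1)) + τ • (F (X (k + 1)) - F (Y (k + 1)))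
      + (X k - (X (k + 1) + τ • F (X (k + 1)))) := by
    rw [hY k hk, smul_sub]; abel
  calc _ ≤ ‖X (k + 1) - Y (k + 1)‖ + τ * ‖F (X (k + 1)) - F (Y (k + 1))‖
        + ‖X k - (X (k + 1) + τ • F (X (k + 1)))‖ := by
        rw [e, ← Real.norm_of_nonneg hτ, ← norm_smul, Real.norm_of_nonneg hτ]
        exact norm_add₃_le
    _ ≤ ‖X (k + 1) - Y (k + 1)‖ + τ * (L * ‖X (k + 1) - Y (k + 1)‖) + τ * b := by
        gcongr
        exacts [hF k hk, hX k hk]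
    _ = _ := by ring

end Riccati

open Riccati
open scoped Matrix.Norms.L2Operator

theorem stmt17 {n m : ℕ} (T : ℝ) (hT : 0 < T)
    (A Cm Q G : Matrix (Fin n) (Fin n) ℝ) (B D : Matrix (Fin n) (Fin m) ℝ)
    (R : Matrix (Fin m) (Fin m) ℝ)
    (hQ : Q.PosSemidef) (hG : G.PosSemidef) (hR : R.PosDef)
    (P P' : ℝ → Matrix (Fin n) (Fin n) ℝ)
    (hder : ∀ i j, ∀ t ∈ Icc 0 T, HasDerivAt (fun s => P s i j) (P' t i j) t)
    (hcont : ∀ i j, ContinuousOn (fun t => P' t i j) (Icc 0 T))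
    (hpsd : ∀ t ∈ Icc 0 T, (P t).PosSemidef)
    (hPT : P T = G)
    (hric : ∀ t ∈ Icc 0 T,
      P' t + P t * A + Aᵀ * P t + Cmᵀ * P t * Cm + Q
        - (Bᵀ * P t + Dᵀ * P t * Cm)ᵀ * (R + Dᵀ * P t * D)⁻¹
            * (Bᵀ * P t + Dᵀ * P t * Cm) = 0) :
    ∃ C₀ : ℝ,
      (∀ t ∈ Icc 0 T, sNorm (P t) ≤ C₀) ∧
      (∀ s ∈ Icc 0 T, ∀ t ∈ Icc 0 T, sNorm (P t - P s) ≤ C₀ * |t - s|) ∧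
      ∀ N : ℕ, 0 < N → T / (N : ℝ) ≤ 1 →
        ∀ Pd : ℕ → Matrix (Fin n) (Fin n) ℝ,
          Pd N = G →
          (∀ k < N, Pd k =
            (T / (N : ℝ)) • Q
              + (1 + (T / (N : ℝ)) • A)ᵀ * Pd (k + 1) * (1 + (T / (N : ℝ)) • A)
              + (T / (N : ℝ)) • (Cmᵀ * Pd (k + 1) * Cm)
              - (T / (N : ℝ)) • ((Bᵀ * Pd (k + 1) * (1 + (T / (N : ℝ)) • A)
                    + Dᵀ * Pd (k + 1) * Cm)ᵀ
                  * (R + (T / (N : ℝ)) • (Bᵀ * Pd (k + 1) * B) + Dᵀ * Pd (k + 1) * D)⁻¹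
                  * (Bᵀ * Pd (k + 1) * (1 + (T / (N : ℝ)) • A)
                    + Dᵀ * Pd (k + 1) * Cm))) →
          (∀ l ≤ N, sNorm (Pd l) ≤ C₀) ∧
          (∀ k ≤ N, sNorm (P ((k : ℝ) * (T / (N : ℝ))) - Pd k)
              ≤ C₀ * Real.sqrt (T / (N : ℝ))) := by
  have hder' : ∀ t ∈ Icc 0 T, HasDerivAt P (-increment A Cm Q B D R 0 (P t)) t := fun t ht =>
    increment_zero_eq_neg (hric t ht) ▸ hasDerivAt_of_entries fun i j => hder i j t ht
  obtain ⟨M₁, hM₁⟩ := isCompact_Icc.exists_bound_of_continuousOn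
    (fun t ht => (hder' t ht).continuousAt.continuousWithinAt : ContinuousOn P (Icc 0 T))
  obtain ⟨M₂, hM₂⟩ : ∃ M₂, M₂ = Real.exp ((2 * ‖A‖ + ‖A‖ ^ 2 + ‖Cm‖ ^ 2) * T)
    * (‖G‖ + T * ‖Q‖) := ⟨_, rfl⟩
  obtain ⟨M, hM₁M, hM₂M⟩ : ∃ M, M₁ ≤ M ∧ M₂ ≤ M := ⟨max M₁ M₂, le_max_left _ _, le_max_right _ _⟩
  have hM : 0 ≤ M := (norm_nonneg _).trans ((hM₁ T ⟨hT.le, le_rfl⟩).trans hM₁M)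
  obtain ⟨L, hL, hLb, hLl⟩ := boundedLipschitzOn_increment A Cm Q B D hR hM
  have hadm : ∀ τ ∈ Icc (0 : ℝ) 1, ∀ t ∈ Icc 0 T, (τ, P t) ∈ admissible n M := fun τ hτ t ht =>
    ⟨hτ, hpsd t ht, (hM₁ t ht).trans hM₁M⟩
  have h01 : (0 : ℝ) ∈ Icc (0 : ℝ) 1 := ⟨le_rfl, zero_le_one⟩
  have hlip : ∀ s ∈ Icc 0 T, ∀ t ∈ Icc 0 T, ‖P t - P s‖ ≤ L * |t - s| := fun s hs t ht =>
    (convex_Icc 0 T).norm_image_sub_le_of_norm_hasDerivWithin_le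
      (fun x hx => (hder' x hx).hasDerivWithinAt)
      (fun x hx => by rw [norm_neg]; exact hLb (0, P x) (hadm 0 h01 x hx)) hs ht
  have hK : 0 ≤ Real.exp (L * T) * (T * (L * (1 + L))) := by positivity
  refine ⟨M + L + Real.exp (L * T) * (T * (L * (1 + L))), fun t ht => ?_, fun s hs t ht => ?_,
    fun N hN hτ1 Pd hPdN hPd => ?_⟩
  · exact (hM₁ t ht).trans (by linarith)
  · exact (hlip s hs t ht).trans (by gcongr; linarith)
  have hN' : (0 : ℝ) < N := by exact_mod_cast hN
  have hNτ : N * (T / N) = T := by field_simp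
  have hτ : 0 < T / N := by positivity
  generalize T / (N : ℝ) = τ at *
  have hstep : ∀ k < N, Pd k = Pd (k + 1) + τ • increment A Cm Q B D R τ (Pd (k + 1)) :=
    fun k hk => by rw [add_smul_increment]; exact hPd k hk
  have hPdb := posSemidef_and_norm_le_of_recursion hQ hR hτ.le hτ1 (hPdN ▸ hG) hstep
  rw [hNτ, hPdN, ← hM₂] at hPdb
  refine ⟨fun l hl => ((hPdb l hl).2.trans hM₂M).trans (by linarith), fun k hk => ?_⟩
  have hmesh : ∀ k : ℕ, k ≤ N → (k : ℝ) * τ ∈ Icc 0 T := fun k hk =>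
    ⟨by positivity, by rw [← hNτ]; gcongr⟩
  have hτI : τ ∈ Icc (0 : ℝ) 1 := ⟨hτ.le, hτ1⟩
  have hlocal : ∀ k < N, ‖P (k * τ) - (P ((k + 1 : ℕ) * τ)
      + τ • increment A Cm Q B D R τ (P ((k + 1 : ℕ) * τ)))‖ ≤ τ * (τ * (L * (1 + L))) := by
    intro k hk
    have htI : ((k + 1 : ℕ) : ℝ) * τ ∈ Icc 0 T := hmesh (k + 1) hk
    have hsI : (k : ℝ) * τ ∈ Icc 0 T := hmesh k hk.le
    have hst : ((k + 1 : ℕ) : ℝ) * τ - k * τ = τ := by push_cast; ring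
    generalize ((k + 1 : ℕ) : ℝ) * τ = t at *
    generalize (k : ℝ) * τ = s at *
    have hsub : Icc s t ⊆ Icc 0 T := Icc_subset_Icc hsI.1 htI.2
    have h := norm_sub_add_smul_le (F := increment A Cm Q B D R) (C := τ * (L * (1 + L)))
      (by linarith) (fun x hx => hder' x (hsub hx)) (fun x hx => ?_)
    · rwa [hst] at h
    rw [hst]
    refine (hLl (τ, P t) (hadm τ hτI t htI) (0, P x) (hadm 0 h01 x (hsub hx))).trans ?_
    have h1 : ‖P t - P x‖ ≤ L * τ := (hlip x (hsub hx) t htI).trans (by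
      gcongr
      rw [abs_of_nonneg (by linarith [hx.2])]
      linarith [hx.1])
    have h2 : dist (τ, P t) ((0 : ℝ), P x) ≤ τ * (1 + L) := by
      rw [Prod.dist_eq, Real.dist_eq, sub_zero, abs_of_pos hτ, dist_eq_norm]
      refine max_le ?_ (h1.trans ?_) <;> nlinarith
    calc _ ≤ L * (τ * (1 + L)) := by gcongr
      _ = _ := by ring
  have h := norm_sub_le_of_local_error (F := increment A Cm Q B D R τ)
    (X := fun k => P (k * τ)) hτ.le hL (by positivity) (by rw [hNτ, hPT, hPdN]) hstep hlocal
    (fun k hk => by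
      have h := hLl (τ, P ((k + 1 : ℕ) * τ)) (hadm τ hτI _ (hmesh (k + 1) hk)) (τ, Pd (k + 1))
        ⟨hτI, (hPdb (k + 1) hk).1, (hPdb (k + 1) hk).2.trans hM₂M⟩
      rwa [Prod.dist_eq, dist_self, dist_eq_norm, max_eq_right (norm_nonneg _)] at h) k hk
  rw [hNτ] at h
  have hsq : τ ≤ √τ := Real.le_sqrt_of_sq_le (by nlinarith)
  calc _ ≤ Real.exp (L * T) * (T * (L * (1 + L))) * τ := h.trans_eq (by ring)
    _ ≤ _ := by gcongr; linarith
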